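/- Let 𝔞 be a proper ideal of R and M a finitely generated R-module. Let x₁, …, x_n be a part of an 𝔞-relative system of parameters of R that is both an M-regular and an R-regular sequence, and set R̄ = R/(x₁, …, x_n), M̄ = M/(x₁, …, x_n)M. Then M is 𝔞-relative Gorenstein over R if and only if M̄ is 𝔞R̄-relative Gorenstein over R̄. -/

import Mathlib

open CategoryTheory TensorProduct

noncomputable section

universe u

/-- The cohomological dimension `cd(𝔞, M)`: the largest `i` (in `ℕ∞`) such that the local
cohomology module `H^i_𝔞(M)` is nonzero. -/
noncomputable def cohDim {R : Type u} [CommRing R] (a : Ideal R)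
    (M : Type u) [AddCommGroup M] [Module R M] : ℕ∞ :=
  sSup ((fun i : ℕ => (i : ℕ∞)) ''
    {i : ℕ | Nontrivial ((localCohomology a i).obj (ModuleCat.of R M))})

/-- The grade `grade(𝔞, M)`: the least `i` (in `ℕ∞`) such that `Ext^i_R(R/𝔞, M) ≠ 0`. -/
noncomputable def relGrade {R : Type u} [CommRing R] (a : Ideal R)
    (M : Type u) [AddCommGroup M] [Module R M] : ℕ∞ :=
  sInf ((fun i : ℕ => (i : ℕ∞)) ''
    {i : ℕ | Nontrivial (((Ext R (ModuleCat.{u} R) i).obj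
      (Opposite.op (ModuleCat.of R (R ⧸ a)))).obj (ModuleCat.of R M))})

/-- `M` is `𝔞`-relative Cohen-Macaulay: `M = 𝔞M`, or `M ≠ 𝔞M` and `grade(𝔞,M) = cd(𝔞,M)`. -/
def IsRelCM {R : Type u} [CommRing R] (a : Ideal R)
    (M : Type u) [AddCommGroup M] [Module R M] : Prop :=
  a • (⊤ : Submodule R M) = ⊤ ∨
    (a • (⊤ : Submodule R M) ≠ ⊤ ∧ relGrade a M = cohDim a M)

/-- `M` is `𝔞`-relative maximal Cohen-Macaulay: `grade(𝔞,M) = cd(𝔞,R)`. -/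
def IsRelMCM {R : Type u} [CommRing R] (a : Ideal R)
    (M : Type u) [AddCommGroup M] [Module R M] : Prop :=
  relGrade a M = cohDim a R

/-- `M` is `𝔞`-relative Gorenstein: `Ext^i_R(R/𝔞, M) = 0` for all `i ≠ cd(𝔞,R)`. -/
def IsRelGorenstein {R : Type u} [CommRing R] (a : Ideal R)
    (M : Type u) [AddCommGroup M] [Module R M] : Prop :=
  ∀ i : ℕ, (i : ℕ∞) ≠ cohDim a R →
    Subsingleton (((Ext R (ModuleCat.{u} R) i).obj
      (Opposite.op (ModuleCat.of R (R ⧸ a)))).obj (ModuleCat.of R M))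

/-- `M` is `𝔞`-relative regular: `M = 𝔞M`, or `M ≠ 𝔞M` and `𝔞` is generated by a sequence of
length `cd(𝔞,R)` which is both an `M`-regular sequence and an `R`-regular sequence. -/
def IsRelRegular {R : Type u} [CommRing R] (a : Ideal R)
    (M : Type u) [AddCommGroup M] [Module R M] : Prop :=
  a • (⊤ : Submodule R M) = ⊤ ∨
    (a • (⊤ : Submodule R M) ≠ ⊤ ∧ ∃ rs : List R,
      (rs.length : ℕ∞) = cohDim a R ∧ Ideal.span {x | x ∈ rs} = a ∧
      RingTheory.Sequence.IsRegular M rs ∧ RingTheory.Sequence.IsRegular R rs)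

/-- A ring map (given as an algebra) `R → T` is pure if `N → T ⊗[R] N`, `n ↦ 1 ⊗ n`,
is injective for every `R`-module `N`. -/
def IsPureAlgebra (R T : Type u) [CommRing R] [CommRing T] [Algebra R T] : Prop :=
  ∀ (N : Type u) [AddCommGroup N] [Module R N],
    Function.Injective (fun n : N => (1 : T) ⊗ₜ[R] n)

/-- `rs` is an `𝔞`-relative system of parameters of `M`: it has length `cd(𝔞,M)`, consists of
elements of `𝔞`, and `Rad(⟨rs⟩ + Ann M) = Rad(𝔞 + Ann M)`. -/
def IsRelSOP {R : Type u} [CommRing R] (a : Ideal R)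
    (M : Type u) [AddCommGroup M] [Module R M] (rs : List R) : Prop :=
  (rs.length : ℕ∞) = cohDim a M ∧ (∀ x ∈ rs, x ∈ a) ∧
    (Ideal.span {x | x ∈ rs} + Module.annihilator R M).radical =
      (a + Module.annihilator R M).radical

section Aux18

variable {R : Type u} [CommRing R]

/-- map -/
def lyMap {P Q : ChainComplex (ModuleCat.{u} R) ℕ} (φ : P ⟶ Q) (N : ModuleCat.{u} R) :
    Q.linearYonedaObj R N ⟶ P.linearYonedaObj R N :=
  (HomologicalComplex.unopFunctor _ _).map ((((linearYoneda R (ModuleCat.{u} R)).obj N).rightOp.mapHomologicalComplex _).map φ).op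

theorem lyMap_f {P Q : ChainComplex (ModuleCat.{u} R) ℕ} (φ : P ⟶ Q) (N : ModuleCat.{u} R) (i : ℕ) (f : Q.X i ⟶ N) : (lyMap φ N).f i f = φ.f i ≫ f := rfl

theorem aux_comm {C : Type*} [Category C] {E E' A A' H H' : C} {e : E ⟶ E'} {p : E ⟶ A} {p' : E' ⟶ A'}
   {m : A ⟶ A'} {q : H ≅ A} {q' : H' ≅ A'} {h : H ⟶ H'} (h1 : e ≫ p' = p ≫ m) (h2 : h ≫ q'.hom = q.hom ≫ m) :
   e ≫ p' ≫ q'.inv = (p ≫ q.inv) ≫ h := by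
  have : q.inv ≫ h = m ≫ q'.inv := by
    rw [Iso.inv_comp_eq, ← Category.assoc, ← h2]; simp
  rw [Category.assoc, this, ← Category.assoc, h1, Category.assoc]

theorem isoExt_nat {X X' N : ModuleCat.{u} R} (g : X' ⟶ X) (P : ProjectiveResolution X)
    (P' : ProjectiveResolution X') (φ : P'.complex ⟶ P.complex)
    (comm : φ.f 0 ≫ P.π.f 0 = P'.π.f 0 ≫ g) (i : ℕ) :
    (((Ext R (ModuleCat.{u} R) i).map g.op).app N) ≫ (P'.isoExt i N).hom =
      (P.isoExt i N).hom ≫ HomologicalComplex.homologyMap (lyMap φ N) i := by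
  have h := ProjectiveResolution.isoLeftDerivedObj_inv_naturality g P' P φ comm
    ((linearYoneda R (ModuleCat.{u} R)).obj N).rightOp i
  have h2 := HomologicalComplex.homologyOp_hom_naturality (lyMap φ N) i
  have h' := congrArg Quiver.Hom.unop h
  have h2' := congrArg Quiver.Hom.unop h2
  simp only [unop_comp] at h' h2'
  exact aux_comm (q := ((P.complex.linearYonedaObj R N).homologyOp i).unop) (q' := ((P'.complex.linearYonedaObj R N).homologyOp i).unop) h' h2'.symm

theorem hom_rep (K : CochainComplex (ModuleCat.{u} R) ℕ) (i : ℕ) (y : K.homology i) :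
    ∃ z : K.cycles i, K.homologyπ i z = y ∧ K.d i (i+1) (K.iCycles i z) = 0 := by
  obtain ⟨z, rfl⟩ := (ModuleCat.epi_iff_surjective (K.homologyπ i)).1 inferInstance y
  refine ⟨z, rfl, ?_⟩
  have := K.iCycles_d i (i+1)
  exact congrArg (fun f => f.hom z) this

theorem hom_mk (K : CochainComplex (ModuleCat.{u} R) ℕ) (i : ℕ) (x : K.X i)
    (hx : K.d i (i+1) x = 0) : ∃ z : K.cycles i, K.iCycles i z = x := by
  have hk := K.cyclesIsKernel i (i+1) (by simp)
  let s : Submodule R (K.X i) := LinearMap.ker (K.d i (i+1)).hom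
  let t : ModuleCat.of R s ⟶ K.X i := ModuleCat.ofHom s.subtype
  have ht : t ≫ K.d i (i+1) = 0 := by
    ext a
    exact a.2
  refine ⟨K.liftCycles t (i+1) (by simp) ht ⟨x, hx⟩, ?_⟩
  have := K.liftCycles_i t (i+1) (by simp) ht
  exact congrArg (fun f => f.hom ⟨x, hx⟩) this

theorem hom_zero (K : CochainComplex (ModuleCat.{u} R) ℕ) (i : ℕ) (z : K.cycles i) :
    K.homologyπ i z = 0 ↔ ∃ j, ∃ w : K.X j, (j + 1 = i ∨ w = 0) ∧ K.d j i w = K.iCycles i z := by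
  have hex : (ShortComplex.mk (K.toCycles (ComplexShape.prev _ i) i) (K.homologyπ i) (by simp)).Exact :=
    ShortComplex.exact_of_g_is_cokernel _ (K.homologyIsCokernel _ i rfl)
  rw [ShortComplex.moduleCat_exact_iff] at hex
  have hinj := (ModuleCat.mono_iff_injective (K.iCycles i)).1 inferInstance
  have hd : ∀ j (w : K.X j), K.iCycles i (K.toCycles j i w) = K.d j i w := fun j w =>
    congrArg (fun f => f.hom w) (K.toCycles_i j i)
  constructor
  · intro h
    obtain ⟨w, hw⟩ := hex z h
    by_cases hp : (ComplexShape.up ℕ).Rel ((ComplexShape.up ℕ).prev i) i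
    · exact ⟨_, w, Or.inl hp, by rw [← hd]; exact congrArg _ hw⟩
    · refine ⟨_, (0 : K.X ((ComplexShape.up ℕ).prev i)), Or.inr rfl, ?_⟩
      have h0 : K.d ((ComplexShape.up ℕ).prev i) i = 0 := K.shape _ _ hp
      rw [← (show _ = z from hw)]
      change _ = K.iCycles i (K.toCycles _ i w)
      rw [hd, h0]; simp
  · rintro ⟨j, w, hj, hw⟩
    rw [← hd] at hw
    rw [← hinj hw]
    have := K.toCycles_comp_homologyπ j i
    exact congrArg (fun f => f.hom w) this

open Abelian in
theorem extMk_zero_iff' {X N : ModuleCat.{u} R} (P : ProjectiveResolution X) (i : ℕ) (f : P.complex.X i ⟶ N)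
    (hf : P.complex.d (i+1) i ≫ f = 0) :
    P.extMk f (i+1) rfl hf = 0 ↔ ∃ j, ∃ w : P.complex.X j ⟶ N, (j + 1 = i ∨ w = 0) ∧ P.complex.d i j ≫ w = f := by
  cases i with
  | zero =>
    constructor
    · intro h
      refine ⟨0, 0, Or.inr rfl, ?_⟩
      simp only [← P.extEquivCohomologyClass.apply_eq_iff_eq,
        ProjectiveResolution.extEquivCohomologyClass_extMk, ProjectiveResolution.extEquivCohomologyClass_zero,
        CochainComplex.HomComplex.CohomologyClass.mk_eq_zero_iff] at h
      rw [CochainComplex.HomComplex.Cocycle.toSingleMk_mem_coboundaries_iff _ _ _ _ _ 1 (by simp)] at h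
      obtain ⟨g, hg⟩ := h
      have h0 : Limits.IsZero (P.cochainComplex.X 1) := by
        exact CochainComplex.isZero_of_isStrictlyLE P.cochainComplex 0 1 (by simp)
      have : P.cochainComplex.d (-(0:ℕ)) 1 = 0 := h0.eq_of_tgt _ _
      rw [this, Limits.zero_comp] at hg
      rw [← cancel_epi (P.cochainComplexXIso (-(0:ℕ)) 0 rfl).hom, ← hg]
      simp
    · rintro ⟨j, w, hj, rfl⟩
      obtain rfl : w = 0 := by simpa using hj
      simp
  | succ p =>
    rw [P.extMk_eq_zero_iff f _ rfl hf p rfl]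
    constructor
    · rintro ⟨g, hg⟩
      exact ⟨p, g, Or.inl rfl, hg⟩
    · rintro ⟨j, w, hj, hw⟩
      by_cases h : j = p
      · subst h; exact ⟨w, hw⟩
      · obtain rfl : w = 0 := by
          rcases hj with hj | hj
          · omega
          · exact hj
        exact ⟨0, by simpa using hw⟩

/-- Relation between the two kinds of Ext. -/
def ExtRel {X N : ModuleCat.{u} R} (i : ℕ) (y : ((Ext R (ModuleCat.{u} R) i).obj (Opposite.op X)).obj N)
    (ξ : Abelian.Ext.{u} X N i) : Prop :=
  ∃ (P : ProjectiveResolution X) (z : (P.complex.linearYonedaObj R N).cycles i)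
    (f : P.complex.X i ⟶ N) (hf : P.complex.d (i+1) i ≫ f = 0),
    (P.complex.linearYonedaObj R N).iCycles i z = f ∧
    (P.isoExt i N).hom y = (P.complex.linearYonedaObj R N).homologyπ i z ∧
    ξ = P.extMk f (i+1) rfl hf

theorem extRel_left {X N : ModuleCat.{u} R} (i : ℕ)
    (y : ((Ext R (ModuleCat.{u} R) i).obj (Opposite.op X)).obj N) : ∃ ξ, ExtRel i y ξ := by
  let P := projectiveResolution X
  obtain ⟨z, hz, hz'⟩ := hom_rep _ i ((P.isoExt i N).hom y)
  exact ⟨_, P, z, _, hz', rfl, hz.symm, rfl⟩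

theorem extRel_right {X N : ModuleCat.{u} R} (i : ℕ)
    (ξ : Abelian.Ext.{u} X N i) : ∃ y, ExtRel i y ξ := by
  let P := projectiveResolution X
  obtain ⟨f, hf, rfl⟩ := P.extMk_surjective ξ (i+1) rfl
  obtain ⟨z, hz⟩ := hom_mk (P.complex.linearYonedaObj R N) i f hf
  refine ⟨(P.isoExt i N).inv ((P.complex.linearYonedaObj R N).homologyπ i z), P, z, f, hf, hz, ?_, rfl⟩
  exact congrArg (fun f => f.hom ((P.complex.linearYonedaObj R N).homologyπ i z)) (P.isoExt i N).inv_hom_id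

theorem extRel_zero {X N : ModuleCat.{u} R} {i : ℕ}
    {y : ((Ext R (ModuleCat.{u} R) i).obj (Opposite.op X)).obj N}
    {ξ : Abelian.Ext.{u} X N i} (h : ExtRel i y ξ) : y = 0 ↔ ξ = 0 := by
  obtain ⟨P, z, f, hf, hz, hy, rfl⟩ := h
  have : y = 0 ↔ (P.isoExt i N).hom y = 0 := by
    constructor
    · rintro rfl; simp
    · intro h
      have := congrArg (P.isoExt i N).inv h
      simpa using this
  rw [this, hy, hom_zero, extMk_zero_iff', hz]
  rfl

theorem extRel_nat {X X' N : ModuleCat.{u} R} (g : X' ⟶ X) {i : ℕ}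
    {y : ((Ext R (ModuleCat.{u} R) i).obj (Opposite.op X)).obj N}
    {ξ : Abelian.Ext.{u} X N i} (h : ExtRel i y ξ) :
    ExtRel i (((Ext R (ModuleCat.{u} R) i).map g.op).app N y)
      ((Abelian.Ext.mk₀ g).comp ξ (zero_add i)) := by
  obtain ⟨P, z, f, hf, hz, hy, rfl⟩ := h
  let P' := projectiveResolution X'
  let φ := ProjectiveResolution.lift g P' P
  have comm := ProjectiveResolution.lift_commutes_zero g P' P
  let Φ : ProjectiveResolution.Hom P' P g := ⟨φ, by simpa using comm⟩
  refine ⟨P', HomologicalComplex.cyclesMap (lyMap φ N) i z, φ.f i ≫ f, by simp [← φ.comm_assoc, hf], ?_, ?_, ?_⟩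
  · have := HomologicalComplex.cyclesMap_i (lyMap φ N) i
    have := congrArg (fun f => f.hom z) this
    refine this.trans ?_
    rw [← lyMap_f, ← hz]; rfl
  · have := isoExt_nat (N := N) g P P' φ comm i
    refine (congrArg (fun f => f.hom y) this).trans ?_
    have h2 := HomologicalComplex.homologyπ_naturality (lyMap φ N) i
    refine Eq.trans ?_ (congrArg (fun f => f.hom z) h2)
    change (HomologicalComplex.homologyMap (lyMap φ N) i) _ = (HomologicalComplex.homologyMap (lyMap φ N) i) _
    exact congrArg _ hy
  · exact ProjectiveResolution.mk₀_comp_extMk f (i+1) rfl hf Φ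

theorem ext_subsingleton_iff {X N : ModuleCat.{u} R} (i : ℕ) :
    Subsingleton (((Ext R (ModuleCat.{u} R) i).obj (Opposite.op X)).obj N) ↔
      Subsingleton (Abelian.Ext.{u} X N i) := by
  constructor
  · intro h
    refine subsingleton_of_forall_eq 0 fun ξ => ?_
    obtain ⟨y, hy⟩ := extRel_right i ξ
    exact (extRel_zero hy).1 (Subsingleton.elim _ _)
  · intro h
    refine subsingleton_of_forall_eq 0 fun ξ => ?_
    obtain ⟨y, hy⟩ := extRel_left i ξ
    exact (extRel_zero hy).2 (Subsingleton.elim _ _)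

open Limits


/-- The transition map `R/a^l → R/a^k`. -/
def qmap (a : Ideal R) {k l : ℕ} (h : k ≤ l) :
    ModuleCat.of R (R ⧸ a ^ l) ⟶ ModuleCat.of R (R ⧸ a ^ k) :=
  ModuleCat.ofHom (Submodule.mapQ _ _ LinearMap.id (Ideal.pow_le_pow_right h))

/-- Vanishing of local cohomology in terms of `Abelian.Ext`. -/
def LCV (a : Ideal R) (N : ModuleCat.{u} R) (i : ℕ) : Prop :=
  ∀ (k : ℕ) (ξ : Abelian.Ext.{u} (ModuleCat.of R (R ⧸ a ^ k)) N i),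
    ∃ (l : ℕ) (h : k ≤ l), (Abelian.Ext.mk₀ (qmap a h)).comp ξ (zero_add i) = 0

theorem lc_subsingleton_iff (a : Ideal R) (N : ModuleCat.{u} R) (i : ℕ) :
    Subsingleton ((localCohomology a i).obj N) ↔ LCV a N i := by
  let F := localCohomology.diagram (localCohomology.idealPowersDiagram a) i
  have hc : HasColimit F := localCohomology.hasColimitDiagram.{u, 0} _ i
  let ev := (evaluation (ModuleCat.{u} R) (ModuleCat.{u} R)).obj N
  let G := F ⋙ ev
  have hD : IsColimit (ev.mapCocone (colimit.cocone F)) := isColimitOfPreserves ev (colimit.isColimit F)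
  have := preservesFilteredColimitsOfSize_shrink.{0,u,0,u} (forget (ModuleCat.{u} R))
  have hp : PreservesColimit G (forget (ModuleCat.{u} R)) := inferInstance
  have hrep := Concrete.isColimit_exists_rep G hD
  have heq := fun (i j : (ℕᵒᵖ)ᵒᵖ) (x : G.obj i) (y : G.obj j) => Concrete.isColimit_rep_eq_iff_exists G hD x y
  have hmap : ∀ (k l : (ℕᵒᵖ)ᵒᵖ) (f : k ⟶ l), ∃ h : k.unop.unop ≤ l.unop.unop,
      G.map f = (((Ext R (ModuleCat.{u} R) i).map (qmap a h).op).app N) := by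
    intro k l f
    exact ⟨f.unop.unop.down.down, rfl⟩
  have hmap' : ∀ (k l : (ℕᵒᵖ)ᵒᵖ) (h : k.unop.unop ≤ l.unop.unop), ∃ f : k ⟶ l,
      G.map f = (((Ext R (ModuleCat.{u} R) i).map (qmap a h).op).app N) := by
    intro k l h
    exact ⟨(homOfLE h).op.op, rfl⟩
  constructor
  · intro hs k ξ
    obtain ⟨y, hy⟩ := extRel_right i ξ
    let K : (ℕᵒᵖ)ᵒᵖ := Opposite.op (Opposite.op k)
    obtain ⟨L, f, g, hfg⟩ := (heq K K y (0 : ((Ext R (ModuleCat.{u} R) i).obj (Opposite.op (ModuleCat.of R (R ⧸ a ^ k)))).obj N)).1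
      (by
        have : Subsingleton (ev.mapCocone (colimit.cocone F)).pt := hs
        exact @Subsingleton.elim _ this _ _)
    obtain ⟨h, hf⟩ := hmap _ _ f
    obtain ⟨h', hg⟩ := hmap _ _ g
    rw [hf, hg] at hfg
    refine ⟨L.unop.unop, h, ?_⟩
    rw [← extRel_zero (extRel_nat (qmap a h) hy)]
    refine hfg.trans ?_
    exact map_zero (((Ext R (ModuleCat.{u} R) i).map (qmap a h').op).app N).hom
  · intro hs
    refine subsingleton_of_forall_eq 0 fun Y => ?_
    obtain ⟨K, y, rfl⟩ := hrep Y
    obtain ⟨ξ, hξ⟩ := extRel_left i (X := ModuleCat.of R (R ⧸ a ^ K.unop.unop)) (N := N) y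
    obtain ⟨l, hl, h0⟩ := hs _ ξ
    let L : (ℕᵒᵖ)ᵒᵖ := Opposite.op (Opposite.op l)
    obtain ⟨f, hf⟩ := hmap' K L hl
    rw [← extRel_zero (extRel_nat (qmap a hl) hξ)] at h0
    have h1 : (ev.mapCocone (colimit.cocone F)).ι.app K y = (ev.mapCocone (colimit.cocone F)).ι.app K (0 : ((Ext R (ModuleCat.{u} R) i).obj (Opposite.op (ModuleCat.of R (R ⧸ a ^ K.unop.unop)))).obj N) := by
      refine (heq K K y _).2 ⟨L, f, f, ?_⟩
      rw [hf]
      refine h0.trans ?_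
      exact (map_zero (((Ext R (ModuleCat.{u} R) i).map (qmap a hl).op).app N).hom).symm
    exact h1.trans (map_zero ((ev.mapCocone (colimit.cocone F)).ι.app K).hom)


section LCVtheory

open Abelian

theorem qmap_comp (a : Ideal R) {k l m : ℕ} (h : k ≤ l) (h' : l ≤ m) :
    qmap a h' ≫ qmap a h = qmap a (h.trans h') := by
  ext
  rfl

theorem qmap_comp_ext (a : Ideal R) {k l m : ℕ} (h : k ≤ l) (h' : l ≤ m) {N : ModuleCat.{u} R} {i : ℕ}
    (ξ : Abelian.Ext.{u} (ModuleCat.of R (R ⧸ a ^ k)) N i) :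
    (Ext.mk₀ (qmap a h')).comp ((Ext.mk₀ (qmap a h)).comp ξ (zero_add i)) (zero_add i) =
      (Ext.mk₀ (qmap a (h.trans h'))).comp ξ (zero_add i) := by
  rw [Ext.mk₀_comp_mk₀_assoc, qmap_comp]

/-- short complex from linear maps -/
def mkS {A B C : Type u} [AddCommGroup A] [AddCommGroup B] [AddCommGroup C] [Module R A]
    [Module R B] [Module R C] (f : A →ₗ[R] B) (g : B →ₗ[R] C) (h : Function.Exact f g) :
    ShortComplex (ModuleCat.{u} R) :=
  ShortComplex.mk (ModuleCat.ofHom f) (ModuleCat.ofHom g) (by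
    ext x
    exact h.apply_apply_eq_zero x)

theorem mkS_exact {A B C : Type u} [AddCommGroup A] [AddCommGroup B] [AddCommGroup C] [Module R A]
    [Module R B] [Module R C] (f : A →ₗ[R] B) (g : B →ₗ[R] C) (h : Function.Exact f g)
    (hf : Function.Injective f) (hg : Function.Surjective g) : (mkS f g h).ShortExact where
  exact := by
    rw [ShortComplex.moduleCat_exact_iff]
    intro x hx
    exact (h x).1 hx
  mono_f := (ModuleCat.mono_iff_injective _).2 hf
  epi_g := (ModuleCat.epi_iff_surjective _).2 hg

theorem LCV_X2 (a : Ideal R) {S : ShortComplex (ModuleCat.{u} R)} (hS : S.ShortExact) {i : ℕ}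
    (h1 : LCV a S.X₁ i) (h3 : LCV a S.X₃ i) : LCV a S.X₂ i := by
  intro k ξ
  obtain ⟨l, h, hl⟩ := h3 k (ξ.comp (Ext.mk₀ S.g) (add_zero i))
  rw [← Ext.comp_assoc_of_third_deg_zero] at hl
  obtain ⟨η, hη⟩ := Ext.covariant_sequence_exact₂ _ hS _ hl
  obtain ⟨m, h', hm⟩ := h1 l η
  refine ⟨m, h.trans h', ?_⟩
  rw [← qmap_comp_ext a h h', ← hη, ← Ext.comp_assoc_of_third_deg_zero, hm, Ext.zero_comp]

theorem LCV_X1 (a : Ideal R) {S : ShortComplex (ModuleCat.{u} R)} (hS : S.ShortExact) {i : ℕ}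
    (h3 : LCV a S.X₃ i) (h2 : LCV a S.X₂ (i+1)) : LCV a S.X₁ (i+1) := by
  intro k ξ
  obtain ⟨l, h, hl⟩ := h2 k (ξ.comp (Ext.mk₀ S.f) (add_zero (i+1)))
  rw [← Ext.comp_assoc_of_third_deg_zero] at hl
  obtain ⟨η, hη⟩ := Ext.covariant_sequence_exact₁ _ hS _ hl rfl
  obtain ⟨m, h', hm⟩ := h3 l η
  refine ⟨m, h.trans h', ?_⟩
  rw [← qmap_comp_ext a h h', ← hη, ← Ext.comp_assoc _ _ _ (zero_add i) rfl (by omega), hm, Ext.zero_comp]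

theorem LCV_X3 (a : Ideal R) {S : ShortComplex (ModuleCat.{u} R)} (hS : S.ShortExact) {i : ℕ}
    (h2 : LCV a S.X₂ i) (h1 : LCV a S.X₁ (i+1)) : LCV a S.X₃ i := by
  intro k ξ
  obtain ⟨l, h, hl⟩ := h1 k (ξ.comp hS.extClass rfl)
  rw [← Ext.comp_assoc _ _ _ (zero_add i) rfl (by omega)] at hl
  obtain ⟨η, hη⟩ := Ext.covariant_sequence_exact₃ _ hS _ rfl hl
  obtain ⟨m, h', hm⟩ := h2 l η
  refine ⟨m, h.trans h', ?_⟩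
  rw [← qmap_comp_ext a h h', ← hη, ← Ext.comp_assoc_of_third_deg_zero, hm, Ext.zero_comp]

/-- torsion submodule -/
def gam (a : Ideal R) (N : Type u) [AddCommGroup N] [Module R N] : Submodule R N where
  carrier := {n | ∃ k : ℕ, ∀ r ∈ a ^ k, r • n = 0}
  zero_mem' := ⟨0, by simp⟩
  add_mem' := by
    rintro x y ⟨k, hk⟩ ⟨l, hl⟩
    refine ⟨k + l, fun r hr => ?_⟩
    rw [smul_add, hk r (Ideal.pow_le_pow_right (by omega) hr), hl r (Ideal.pow_le_pow_right (by omega) hr), add_zero]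
  smul_mem' := by
    rintro c x ⟨k, hk⟩
    exact ⟨k, fun r hr => by rw [smul_comm, hk r hr, smul_zero]⟩

theorem mem_gam (a : Ideal R) {N : Type u} [AddCommGroup N] [Module R N] (n : N) :
    n ∈ gam a N ↔ ∃ k : ℕ, ∀ r ∈ a ^ k, r • n = 0 := Iff.rfl

theorem factor_injective {A B E : Type u} [AddCommGroup A] [AddCommGroup B] [AddCommGroup E] [Module R A]
    [Module R B] [Module R E] [hE : Module.Injective R E] (α : A →ₗ[R] B) (g : A →ₗ[R] E)
    (h : LinearMap.ker α ≤ LinearMap.ker g) : ∃ h : B →ₗ[R] E, ∀ x, h (α x) = g x := by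
  let g' : LinearMap.range α →ₗ[R] E := (LinearMap.ker α).liftQ g h ∘ₗ α.quotKerEquivRange.symm.toLinearMap
  obtain ⟨e, he⟩ := hE.out (LinearMap.range α).subtype Subtype.val_injective g'
  refine ⟨e, fun x => ?_⟩
  have := he ⟨α x, x, rfl⟩
  simp only [Submodule.subtype_apply] at this
  rw [this]
  have h2 : α.quotKerEquivRange.symm ⟨α x, x, rfl⟩ = Submodule.Quotient.mk x := by
    rw [LinearEquiv.symm_apply_eq]; rfl
  simp [g', h2]

theorem gam_injective [IsNoetherianRing R] (a : Ideal R) (E : Type u) [AddCommGroup E] [Module R E]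
    [Module.Injective R E] : Module.Injective R (gam a E) := by
  apply Module.Baer.injective
  intro J g
  -- uniform exponent
  have huni : ∃ k : ℕ, ∀ j : J, ∀ r ∈ a ^ k, r • g j = 0 := by
    have hfg : (⊤ : Submodule R J).FG := (inferInstance : Module.Finite R J).fg_top
    obtain ⟨s, hs⟩ := hfg
    choose k hk using fun j : J => (g j).2
    refine ⟨s.sup k, fun j r hr => ?_⟩
    have hj : j ∈ Submodule.span R (s : Set J) := hs ▸ Submodule.mem_top
    induction hj using Submodule.span_induction with
    | mem x hx => 
      apply Subtype.ext
      exact hk x r (Ideal.pow_le_pow_right (Finset.le_sup hx) hr)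
    | zero => simp
    | add x y _ _ hx hy => simp [hx, hy]
    | smul c x _ hx => rw [map_smul, smul_comm, hx, smul_zero]
  obtain ⟨k, hk⟩ := huni
  obtain ⟨k0, hk0⟩ := Ideal.exists_pow_inf_eq_pow_smul a (M := R) J
  have hAR := hk0 (k0 + k) (by omega)
  rw [Nat.add_sub_cancel_left] at hAR
  have hle : ∀ x : R, x ∈ a ^ (k0 + k) → x ∈ J → x ∈ a ^ k • J := by
    intro x hx hxJ
    have : x ∈ (a ^ (k0 + k) • ⊤ ⊓ J : Submodule R R) := ⟨by simpa using hx, hxJ⟩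
    rw [hAR] at this
    exact Submodule.smul_mono le_rfl inf_le_right this
  have hkill : ∀ j : J, (j : R) ∈ a ^ (k0 + k) → g j = 0 := by
    intro j hj
    have h1 := hle _ hj j.2
    have h2 : ∀ x (hx : x ∈ a ^ k • J), ∀ hxJ : x ∈ J, g ⟨x, hxJ⟩ = 0 := by
      intro x hx
      induction hx using Submodule.smul_induction_on' with
      | smul r hr n hn =>
        intro hxJ
        have : (⟨r • n, hxJ⟩ : J) = r • ⟨n, hn⟩ := rfl
        rw [this, map_smul, hk _ r hr]
      | add x hx y hy h1 h2 =>
        intro hxJ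
        have hx' := (Submodule.smul_le_right (I := a ^ k) (N := J)) hx
        have hy' := (Submodule.smul_le_right (I := a ^ k) (N := J)) hy
        have : (⟨x + y, hxJ⟩ : J) = ⟨x, hx'⟩ + ⟨y, hy'⟩ := rfl
        rw [this, map_add, h1, h2, add_zero]
    exact h2 _ h1 _
  let α : J →ₗ[R] (R ⧸ a ^ (k0 + k)) := (a ^ (k0 + k)).mkQ ∘ₗ J.subtype
  obtain ⟨h, hh⟩ := factor_injective α ((gam a E).subtype ∘ₗ g) (by
    intro j hj
    have : (j : R) ∈ a ^ (k0 + k) := by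
      have : (a ^ (k0 + k)).mkQ (j : R) = 0 := hj
      exact (Submodule.Quotient.mk_eq_zero _).1 this
    simp [hkill j this])
  have hmem : h (Submodule.Quotient.mk 1) ∈ gam a E := by
    refine ⟨k0 + k, fun r hr => ?_⟩
    rw [← map_smul]
    have : r • (Submodule.Quotient.mk 1 : R ⧸ a ^ (k0 + k)) = 0 := by
      rw [← Submodule.Quotient.mk_smul, Submodule.Quotient.mk_eq_zero]
      simpa using hr
    rw [this, map_zero]
  refine ⟨LinearMap.toSpanSingleton R _ ⟨_, hmem⟩, fun x hx => ?_⟩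
  apply Subtype.ext
  have := hh ⟨x, hx⟩
  simp only [LinearMap.comp_apply, Submodule.subtype_apply] at this
  rw [← this]
  simp only [LinearMap.toSpanSingleton_apply, Submodule.coe_smul, ← map_smul]
  congr 1
  simp only [α, LinearMap.comp_apply, Submodule.subtype_apply, Submodule.mkQ_apply]
  rw [← Submodule.Quotient.mk_smul]; simp

/-- homs out of R/I -/
theorem hom_eq_zero_of_one {I : Ideal R} {N : ModuleCat.{u} R} (f : ModuleCat.of R (R ⧸ I) ⟶ N)
    (h : f.hom (Submodule.Quotient.mk 1) = 0) : f = 0 := by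
  apply ModuleCat.hom_ext
  apply Submodule.linearMap_qext
  ext
  exact h

theorem exists_tors_injective [IsNoetherianRing R] (a : Ideal R) (N : Type u) [AddCommGroup N] [Module R N]
    (hN : ∀ n : N, ∃ k : ℕ, ∀ r ∈ a ^ k, r • n = 0) :
    ∃ (E : Type u) (_ : AddCommGroup E) (_ : Module R E) (_ : Module.Injective R E)
        (_ : ∀ n : E, ∃ k : ℕ, ∀ r ∈ a ^ k, r • n = 0) (f : N →ₗ[R] E), Function.Injective f := by
  let E0 := Injective.under (ModuleCat.of R N)
  let f0 : ModuleCat.of R N ⟶ E0 := Injective.ι _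
  have hf0 : Function.Injective f0.hom := (ModuleCat.mono_iff_injective _).1 inferInstance
  have hI : Injective (ModuleCat.of R E0) := (inferInstance : Injective (Injective.under (ModuleCat.of R N)))
  have : Module.Injective R E0 := by
    apply (Module.injective_iff_injective_object R E0).2
    exact hI
  refine ⟨gam a E0, inferInstance, inferInstance, gam_injective a E0, ?_, ?_⟩
  · rintro ⟨n, k, hk⟩
    exact ⟨k, fun r hr => Subtype.ext (hk r hr)⟩
  · refine ⟨LinearMap.codRestrict _ f0.hom ?_, ?_⟩
    · intro n
      obtain ⟨k, hk⟩ := hN n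
      exact ⟨k, fun r hr => by rw [← map_smul, hk r hr, map_zero]⟩
    · intro x y h
      exact hf0 (congrArg Subtype.val h)

theorem LCV_torsion [IsNoetherianRing R] (a : Ideal R) (i : ℕ) : ∀ (N : Type u) [AddCommGroup N] [Module R N]
    (_ : ∀ n : N, ∃ k : ℕ, ∀ r ∈ a ^ k, r • n = 0), LCV a (ModuleCat.of R N) (i+1) := by
  induction i with
  | zero =>
    intro N _ _ hN
    obtain ⟨E, _, _, hE, hEg, f, hf⟩ := exists_tors_injective a N hN
    have : Injective (ModuleCat.of R E) := Module.injective_object_of_injective_module R E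
    have hex : Function.Exact f (LinearMap.range f).mkQ := LinearMap.exact_map_mkQ_range f
    have hS := mkS_exact f (LinearMap.range f).mkQ hex hf (Submodule.mkQ_surjective _)
    change LCV a (mkS f (LinearMap.range f).mkQ hex).X₁ (0 + 1)
    intro k ξ
    have : Injective (mkS f (LinearMap.range f).mkQ hex).X₂ := this
    obtain ⟨η, hη⟩ := Ext.covariant_sequence_exact₁ _ hS (n₀ := 0) ξ (Ext.eq_zero_of_injective _) rfl
    obtain ⟨g, rfl⟩ := (Ext.mk₀_bijective _ _).2 η
    obtain ⟨e, he⟩ := Submodule.mkQ_surjective (LinearMap.range f) (g.hom (Submodule.Quotient.mk 1))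
    obtain ⟨m, hm⟩ := hEg e
    let φ : ModuleCat.of R (R ⧸ a ^ (max k m)) ⟶ (mkS f (LinearMap.range f).mkQ hex).X₂ :=
      ModuleCat.ofHom (Submodule.liftQ _ (LinearMap.toSpanSingleton R E e) (by
        intro r hr
        rw [LinearMap.mem_ker, LinearMap.toSpanSingleton_apply]
        exact hm r (Ideal.pow_le_pow_right (le_max_right _ _) hr)))
    refine ⟨max k m, le_max_left _ _, ?_⟩
    have hc : qmap a (le_max_left k m) ≫ g = φ ≫ (mkS f (LinearMap.range f).mkQ hex).g := by
      apply ModuleCat.hom_ext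
      apply Submodule.linearMap_qext
      ext
      change g.hom (Submodule.Quotient.mk 1) = (LinearMap.range f).mkQ ((1 : R) • e)
      rw [one_smul, he]
    rw [← hη, Ext.mk₀_comp_mk₀_assoc, hc, ← Ext.mk₀_comp_mk₀_assoc, hS.comp_extClass, Ext.comp_zero]
  | succ i ih =>
    intro N _ _ hN
    obtain ⟨E, _, _, hE, hEg, f, hf⟩ := exists_tors_injective a N hN
    have : Injective (ModuleCat.of R E) := Module.injective_object_of_injective_module R E
    have hex : Function.Exact f (LinearMap.range f).mkQ := LinearMap.exact_map_mkQ_range f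
    have hS := mkS_exact f (LinearMap.range f).mkQ hex hf (Submodule.mkQ_surjective _)
    have : Injective (mkS f (LinearMap.range f).mkQ hex).X₂ := this
    refine LCV_X1 a hS (ih (E ⧸ LinearMap.range f) ?_) ?_
    · intro n
      obtain ⟨e, rfl⟩ := Submodule.mkQ_surjective _ n
      obtain ⟨m, hm⟩ := hEg e
      exact ⟨m, fun r hr => by rw [← map_smul, hm r hr, map_zero]⟩
    · intro k ξ
      exact ⟨k, le_rfl, by rw [Ext.eq_zero_of_injective ξ, Ext.comp_zero]⟩

end LCVtheory


section LCVtheory2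

open Abelian

theorem smul_ext_eq_zero {X Y : ModuleCat.{u} R} {i : ℕ} (r : R) (hX : ∀ x : X, r • x = 0)
    (ξ : Abelian.Ext.{u} X Y i) : r • ξ = 0 := by
  have h0 : r • 𝟙 X = 0 := by
    ext x
    exact hX x
  have : r • ξ = (Ext.mk₀ (r • 𝟙 X)).comp ξ (zero_add i) := by
    rw [Ext.mk₀_smul, Ext.smul_comp, Ext.mk₀_id_comp]
  rw [this, h0, Ext.mk₀_zero, Ext.zero_comp]

theorem LCV_bij (a : Ideal R) (y : R) (hy : y ∈ a) (N : Type u) [AddCommGroup N] [Module R N]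
    (hN : IsUnit (algebraMap R (Module.End R N) y)) (i : ℕ) : LCV a (ModuleCat.of R N) i := by
  intro k ξ
  refine ⟨k, le_rfl, ?_⟩
  have hk : IsUnit (algebraMap R (Module.End R N) (y ^ k)) := by
    rw [map_pow]; exact hN.pow k
  obtain ⟨u, hu⟩ := hk
  let ψ : ModuleCat.of R N ⟶ ModuleCat.of R N := ModuleCat.ofHom (↑u⁻¹ : Module.End R N)
  have h1 : y ^ k • ψ = 𝟙 _ := by
    ext x
    have := LinearMap.congr_fun u.mul_inv x
    rw [hu] at this
    exact this
  have h2 : ξ = y ^ k • (ξ.comp (Ext.mk₀ ψ) (add_zero i)) := by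
    rw [← Ext.comp_smul, ← Ext.mk₀_smul, h1, Ext.comp_mk₀_id]
  have h3 : ξ = 0 := by
    rw [h2]
    apply smul_ext_eq_zero
    intro x
    obtain ⟨x, rfl⟩ := Submodule.Quotient.mk_surjective _ x
    rw [← Submodule.Quotient.mk_smul, Submodule.Quotient.mk_eq_zero]
    exact Ideal.mul_mem_right _ _ (Ideal.pow_mem_pow hy k)
  rw [h3, Ext.comp_zero]

/-- cokernel of localization -/
abbrev CC (y : R) (N : Type u) [AddCommGroup N] [Module R N] : Type u :=
  LocalizedModule (Submonoid.powers y) N ⧸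
    LinearMap.range (LocalizedModule.mkLinearMap (Submonoid.powers y) N)

/-- division map -/
def dv (y : R) (N : Type u) [AddCommGroup N] [Module R N] (s : ℕ) : N →ₗ[R] CC y N where
  toFun m := Submodule.Quotient.mk (LocalizedModule.mk m ⟨y ^ s, s, rfl⟩)
  map_add' m n := by
    rw [← Submodule.Quotient.mk_add]
    congr 1
    rw [LocalizedModule.mk_add_mk, LocalizedModule.mk_eq]
    refine ⟨1, ?_⟩
    simp only [one_smul, Submonoid.smul_def, Submonoid.coe_mul, smul_add, smul_smul]
  map_smul' r m := by
    rw [RingHom.id_apply, ← Submodule.Quotient.mk_smul, LocalizedModule.smul'_mk]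

variable {y : R} {N : Type u} [AddCommGroup N] [Module R N]

theorem dv_surj (c : CC y N) : ∃ s m, dv y N s m = c := by
  obtain ⟨c, rfl⟩ := Submodule.Quotient.mk_surjective _ c
  induction c using LocalizedModule.induction_on with
  | h m s =>
    obtain ⟨_, s, rfl⟩ := s
    exact ⟨s, m, rfl⟩

theorem dv_add (s t : ℕ) (m : N) : dv y N (s + t) (y ^ t • m) = dv y N s m := by
  change Submodule.Quotient.mk _ = Submodule.Quotient.mk _
  congr 1
  rw [LocalizedModule.mk_eq]
  refine ⟨1, ?_⟩
  simp only [one_smul, Submonoid.smul_def, smul_smul, pow_add]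

theorem dv_zero (m : N) : dv y N 0 m = 0 := by
  change Submodule.Quotient.mk _ = _
  rw [Submodule.Quotient.mk_eq_zero]
  refine ⟨m, ?_⟩
  rw [LocalizedModule.mkLinearMap_apply]
  congr 1
  exact Subtype.ext (pow_zero y).symm

theorem dv_pow (s : ℕ) (m : N) : dv y N s (y ^ s • m) = 0 := by
  have := dv_add (y := y) 0 s m
  rw [zero_add] at this
  rw [this, dv_zero]

theorem dv_eq_zero {s : ℕ} {m : N} (h : dv y N s m = 0) :
    ∃ S m', y ^ S • m = y ^ (S + s) • m' := by
  change Submodule.Quotient.mk _ = _ at h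
  rw [Submodule.Quotient.mk_eq_zero] at h
  obtain ⟨m', hm'⟩ := h
  rw [LocalizedModule.mkLinearMap_apply, LocalizedModule.mk_eq] at hm'
  obtain ⟨⟨_, S, rfl⟩, hS⟩ := hm'
  refine ⟨S, m', ?_⟩
  simp only [one_smul, smul_smul] at hS
  rw [pow_add]
  exact hS.symm

theorem PP_aux {N' : Type u} [AddCommGroup N'] [Module R N'] (a : Ideal R) (ys : List R) (n : N) (c : N')
    (h1 : ∀ r : R, r • n = 0 → r • c = 0) (j : ℕ) (h2 : y ^ j • c = 0)
    (h : a ≤ (Ideal.ofList (y :: ys) ⊔ Ideal.torsionOf R N n).radical) :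
    a ≤ (Ideal.ofList ys ⊔ Ideal.torsionOf R N' c).radical := by
  refine h.trans ?_
  rw [Ideal.radical_le_radical_iff, Ideal.ofList_cons]
  refine sup_le (sup_le ?_ ?_) ?_
  · rw [Ideal.span_singleton_le_iff_mem]
    exact ⟨j, Ideal.mem_sup_right ((Ideal.mem_torsionOf_iff _ _).2 h2)⟩
  · exact le_sup_left.trans Ideal.le_radical
  · refine le_trans ?_ (le_sup_right.trans Ideal.le_radical)
    intro r hr
    exact (Ideal.mem_torsionOf_iff _ _).2 (h1 r ((Ideal.mem_torsionOf_iff _ _).1 hr))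

/-- radical condition -/
def PP (a : Ideal R) (ys : List R) (N : Type u) [AddCommGroup N] [Module R N] : Prop :=
  ∀ n : N, a ≤ (Ideal.ofList ys ⊔ Ideal.torsionOf R N n).radical

theorem PP_CC {a : Ideal R} {ys : List R} (h : PP a (y :: ys) N) : PP a ys (CC y N) := by
  intro c
  obtain ⟨s, m, rfl⟩ := dv_surj c
  refine PP_aux a ys m _ ?_ s ?_ (h m)
  · intro r hr
    rw [← map_smul, hr, map_zero]
  · rw [← map_smul, dv_pow]

theorem PP_ker {a : Ideal R} {ys : List R} (h : PP a (y :: ys) N) :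
    PP a ys (LinearMap.ker (LocalizedModule.mkLinearMap (Submonoid.powers y) N)) := by
  rintro ⟨n, hn⟩
  rw [LinearMap.mem_ker, LocalizedModule.mkLinearMap_apply, ← LocalizedModule.zero_mk 1, LocalizedModule.mk_eq] at hn
  obtain ⟨⟨_, j, rfl⟩, hj⟩ := hn
  refine PP_aux a ys n _ ?_ j ?_ (h n)
  · intro r hr
    exact Subtype.ext hr
  · apply Subtype.ext
    simpa [Submonoid.smul_def] using hj

theorem LCV_Ny (a : Ideal R) (hy : y ∈ a) (i : ℕ) :
    LCV a (ModuleCat.of R (LocalizedModule (Submonoid.powers y) N)) i := by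
  apply LCV_bij a y hy
  exact IsLocalizedModule.map_units (S := Submonoid.powers y) (LocalizedModule.mkLinearMap (Submonoid.powers y) N)
    ⟨y, 1, pow_one y⟩

theorem ses1 {A B : Type u} [AddCommGroup A] [AddCommGroup B] [Module R A] [Module R B] (f : A →ₗ[R] B) :
    ∃ h, (mkS (LinearMap.ker f).subtype f.rangeRestrict h).ShortExact := by
  have h : Function.Exact (LinearMap.ker f).subtype f.rangeRestrict := by
    intro x
    constructor
    · intro hx
      exact ⟨⟨x, by simpa using congrArg Subtype.val hx⟩, rfl⟩
    · rintro ⟨x, rfl⟩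
      exact Subtype.ext x.2
  exact ⟨h, mkS_exact _ _ h (Submodule.subtype_injective _) f.surjective_rangeRestrict⟩

theorem ses2 {B : Type u} [AddCommGroup B] [Module R B] (K : Submodule R B) :
    ∃ h, (mkS K.subtype K.mkQ h).ShortExact := by
  have h : Function.Exact K.subtype K.mkQ := LinearMap.exact_subtype_mkQ K
  exact ⟨h, mkS_exact _ _ h (Submodule.subtype_injective _) K.mkQ_surjective⟩

theorem PP_nil [IsNoetherianRing R] {a : Ideal R} (h : PP a [] N) :
    ∀ n : N, ∃ k : ℕ, ∀ r ∈ a ^ k, r • n = 0 := by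
  intro n
  have := h n
  rw [Ideal.ofList_nil, bot_sup_eq] at this
  obtain ⟨k, hk⟩ := Ideal.exists_pow_le_of_le_radical_of_fg this (IsNoetherian.noetherian a)
  exact ⟨k, fun r hr => (Ideal.mem_torsionOf_iff _ _).1 (hk hr)⟩

theorem LCV_big [IsNoetherianRing R] (a : Ideal R) (ys : List R) (hys : ∀ y ∈ ys, y ∈ a) :
    ∀ (N : Type u) [AddCommGroup N] [Module R N], PP a ys N → ∀ i, ys.length < i →
      LCV a (ModuleCat.of R N) i := by
  induction ys with
  | nil =>
    intro N _ _ hN i hi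
    obtain ⟨i, rfl⟩ := Nat.exists_eq_succ_of_ne_zero (Nat.ne_of_gt hi)
    exact LCV_torsion a i N (PP_nil hN)
  | cons y ys ih =>
    intro N _ _ hN i hi
    obtain ⟨i, rfl⟩ := Nat.exists_eq_succ_of_ne_zero (by omega : i ≠ 0)
    rw [List.length_cons] at hi
    have ih := ih (fun z hz => hys z (by simp [hz]))
    obtain ⟨_, hS1⟩ := ses1 (LocalizedModule.mkLinearMap (Submonoid.powers y) N)
    obtain ⟨_, hS2⟩ := ses2 (LinearMap.range (LocalizedModule.mkLinearMap (Submonoid.powers y) N))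
    exact LCV_X2 a hS1 (ih _ (PP_ker hN) _ (by omega)) (LCV_X1 a hS2 (ih _ (PP_CC hN) i (by omega)) (LCV_Ny a (hys y (by simp)) _))

theorem LCV_step [IsNoetherianRing R] (a : Ideal R) (ys : List R) (hys : ∀ z ∈ y :: ys, z ∈ a)
    (hN : PP a (y :: ys) N) : LCV a (ModuleCat.of R N) (ys.length + 1) ↔
      LCV a (ModuleCat.of R (CC y N)) ys.length := by
  have hb := LCV_big a ys (fun z hz => hys z (by simp [hz])) _ (PP_ker hN)
  obtain ⟨_, hS1⟩ := ses1 (LocalizedModule.mkLinearMap (Submonoid.powers y) N)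
  obtain ⟨_, hS2⟩ := ses2 (LinearMap.range (LocalizedModule.mkLinearMap (Submonoid.powers y) N))
  constructor
  · intro h
    exact LCV_X3 a hS2 (LCV_Ny a (hys y (by simp)) _) (LCV_X3 a hS1 h (hb _ (by omega)))
  · intro h
    exact LCV_X2 a hS1 (hb _ (by omega)) (LCV_X1 a hS2 h (LCV_Ny a (hys y (by simp)) _))

/-- power ideal -/
abbrev IL (ys : List R) (k : ℕ) : Ideal R := Ideal.ofList (ys.map (· ^ k))

/-- explicit vanishing condition -/
def EE (ys : List R) (N : Type u) [AddCommGroup N] [Module R N] : Prop :=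
  ∀ (m : N) (k : ℕ), ∃ l, ys.prod ^ l • m ∈ IL ys (k + l) • (⊤ : Submodule R N)

theorem prod_IL (ys : List R) (k t : ℕ) : ∀ z ∈ IL ys k, ys.prod ^ t * z ∈ IL ys (k + t) := by
  intro z hz
  induction hz using Submodule.span_induction with
  | mem z hz =>
    obtain ⟨y, hy, rfl⟩ := List.mem_map.1 hz
    obtain ⟨c, hc⟩ := List.dvd_prod hy
    have : ys.prod ^ t * y ^ k = c ^ t * y ^ (k + t) := by rw [hc]; ring
    rw [this]
    exact Ideal.mul_mem_left _ _ (Ideal.subset_span (List.mem_map.2 ⟨y, hy, rfl⟩))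
  | zero => simp
  | add x y _ _ hx hy => rw [mul_add]; exact add_mem hx hy
  | smul c x _ hx => rw [smul_eq_mul, mul_left_comm]; exact Ideal.mul_mem_left _ _ hx

theorem prod_IL' (ys : List R) (k t : ℕ) (m : N) (hm : m ∈ IL ys k • (⊤ : Submodule R N)) :
    ys.prod ^ t • m ∈ IL ys (k + t) • (⊤ : Submodule R N) := by
  induction hm using Submodule.smul_induction_on' with
  | smul r hr n hn =>
    rw [smul_smul]
    exact Submodule.smul_mem_smul (prod_IL ys k t r hr) hn
  | add x hx y hy h1 h2 => rw [smul_add]; exact add_mem h1 h2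

theorem IL_anti (ys : List R) {k l : ℕ} (h : k ≤ l) : IL ys l ≤ IL ys k := by
  rw [IL, Ideal.ofList, Ideal.span_le]
  intro z hz
  obtain ⟨y, hy, rfl⟩ := List.mem_map.1 hz
  obtain ⟨t, rfl⟩ := Nat.exists_eq_add_of_le h
  rw [SetLike.mem_coe, pow_add]
  exact Ideal.mul_mem_right _ _ (Ideal.subset_span (List.mem_map.2 ⟨y, hy, rfl⟩))

theorem mem_IL_cons (ys : List R) (k : ℕ) (m : N) : m ∈ IL (y :: ys) k • (⊤ : Submodule R N) ↔
    ∃ m', ∃ w ∈ IL ys k • (⊤ : Submodule R N), m = y ^ k • m' + w := by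
  rw [IL, List.map_cons, Ideal.ofList_cons, Submodule.sup_smul, Submodule.mem_sup]
  constructor
  · rintro ⟨u, hu, w, hw, rfl⟩
    rw [Submodule.ideal_span_singleton_smul] at hu
    obtain ⟨m', -, rfl⟩ := (Submodule.mem_smul_pointwise_iff_exists _ _ _).1 hu
    exact ⟨m', w, hw, rfl⟩
  · rintro ⟨m', w, hw, rfl⟩
    exact ⟨_, Submodule.smul_mem_smul (Ideal.mem_span_singleton_self _) trivial, w, hw, rfl⟩

theorem dv_mem (I : Ideal R) (s : ℕ) (w : N) (hw : w ∈ I • (⊤ : Submodule R N)) :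
    dv y N s w ∈ I • (⊤ : Submodule R (CC y N)) := by
  have := Submodule.mem_map_of_mem (f := dv y N s) hw
  rw [Submodule.map_smul''] at this
  exact Submodule.smul_mono le_rfl le_top this

theorem mem_dv (I : Ideal R) (c : CC y N) (hc : c ∈ I • (⊤ : Submodule R (CC y N))) :
    ∃ s, ∃ w ∈ I • (⊤ : Submodule R N), dv y N s w = c := by
  induction hc using Submodule.smul_induction_on' with
  | smul r hr c _ =>
    obtain ⟨s, m, rfl⟩ := dv_surj c
    exact ⟨s, r • m, Submodule.smul_mem_smul hr trivial, map_smul _ _ _⟩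
  | add c hc d hd h1 h2 =>
    obtain ⟨s, w, hw, rfl⟩ := h1
    obtain ⟨t, v, hv, rfl⟩ := h2
    refine ⟨s + t, y ^ t • w + y ^ s • v, add_mem (Submodule.smul_mem _ _ hw) (Submodule.smul_mem _ _ hv), ?_⟩
    rw [map_add, dv_add, add_comm s t, dv_add]

theorem EE_step (ys : List R) : EE (y :: ys) N ↔ EE ys (CC y N) := by
  constructor
  · intro h c k
    obtain ⟨j, m, rfl⟩ := dv_surj c
    obtain ⟨l, hl⟩ := h m (k + j)
    obtain ⟨m', w, hw, he⟩ := (mem_IL_cons ys _ _).1 hl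
    refine ⟨l, ?_⟩
    have : ys.prod ^ l • dv y N j m = dv y N (j + l) w := by
      rw [← map_smul, ← dv_add j l, smul_smul, ← mul_pow, ← List.prod_cons, he, map_add,
        show k + j + l = (j + l) + k by ring, pow_add y (j + l) k, mul_smul, dv_pow, zero_add]
    rw [this]
    exact dv_mem _ _ _ (Submodule.smul_mono_left (IL_anti ys (by omega)) hw)
  · intro h m k
    obtain ⟨l, hl⟩ := h (dv y N k m) k
    obtain ⟨s, w, hw, he⟩ := mem_dv _ _ hl
    have h0 : dv y N (k + s) (y ^ s • ys.prod ^ l • m - y ^ k • w) = 0 := by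
      rw [map_sub, dv_add, add_comm k s, dv_add, he, map_smul, sub_self]
    obtain ⟨S, m', hS⟩ := dv_eq_zero h0
    refine ⟨l + (S + s), (mem_IL_cons _ _ _).2 ⟨ys.prod ^ (S + s) • m', ys.prod ^ (S + s) • (y ^ (l + S + k) • w),
      ?_, ?_⟩⟩
    · rw [← add_assoc k l]
      exact prod_IL' _ _ _ _ (Submodule.smul_mem _ _ hw)
    · have h2 : y ^ (S + s) • ys.prod ^ l • m = y ^ (S + k) • w + y ^ (S + (k + s)) • m' := by
        rw [← hS, smul_sub, smul_smul (y ^ S), smul_smul (y ^ S) (y ^ k), ← pow_add, ← pow_add]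
        abel
      have h3 := congrArg (fun z => (y ^ l * ys.prod ^ (S + s)) • z) h2
      simp only [smul_add, smul_smul] at h3
      rw [smul_smul, smul_smul]
      convert h3 using 1
      · rw [List.prod_cons]
        congr 1
        ring
      · rw [add_comm]
        congr 2 <;> ring

theorem LCV_iff_EE [IsNoetherianRing R] (a : Ideal R) (ys : List R) (hys : ∀ y ∈ ys, y ∈ a) :
    ∀ (N : Type u) [AddCommGroup N] [Module R N], PP a ys N →
      (LCV a (ModuleCat.of R N) ys.length ↔ EE ys N) := by
  induction ys with
  | nil =>
    intro N _ _ hN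
    constructor
    · intro h m k
      refine ⟨0, ?_⟩
      obtain ⟨k, hk⟩ := PP_nil hN m
      let φ : ModuleCat.of R (R ⧸ a ^ k) ⟶ ModuleCat.of R N :=
        ModuleCat.ofHom (Submodule.liftQ _ (LinearMap.toSpanSingleton R N m) (by
          intro r hr
          rw [LinearMap.mem_ker, LinearMap.toSpanSingleton_apply]
          exact hk r hr))
      obtain ⟨l, h, hl⟩ := h k (Ext.mk₀ φ)
      rw [Ext.mk₀_comp_mk₀, Ext.mk₀_eq_zero_iff] at hl
      have h3 : φ.hom (Submodule.Quotient.mk 1) = 0 := 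
        congrArg (fun f => f.hom (Submodule.Quotient.mk 1 : R ⧸ a ^ l)) hl
      have h4 : (1 : R) • m = 0 := h3
      rw [one_smul] at h4
      simp [h4]
    · intro h k ξ
      have : ∀ m : N, m = 0 := by
        intro m
        obtain ⟨l, hl⟩ := h m 0
        simpa [IL] using hl
      obtain ⟨f, rfl⟩ := (Ext.mk₀_bijective _ _).2 ξ
      have hf : f = 0 := by
        ext
        exact this _
      exact ⟨k, le_rfl, by rw [hf, Ext.mk₀_zero, Ext.comp_zero]⟩
  | cons y ys ih =>
    intro N _ _ hN
    rw [List.length_cons, LCV_step a ys hys hN, EE_step]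
    exact ih (fun z hz => hys z (by simp [hz])) _ (PP_CC hN)

end LCVtheory2


section CD

theorem PP_ring (a : Ideal R) (ys : List R) (h : a ≤ (Ideal.ofList ys).radical) : PP a ys R := by
  intro n
  exact h.trans (Ideal.radical_mono le_sup_left)

theorem nontrivial_lc (a : Ideal R) (i : ℕ) :
    Nontrivial ((localCohomology a i).obj (ModuleCat.of R R)) ↔ ¬ LCV a (ModuleCat.of R R) i := by
  rw [← lc_subsingleton_iff, not_subsingleton_iff_nontrivial]

theorem cd_le [IsNoetherianRing R] (a : Ideal R) (ys : List R) (hys : ∀ y ∈ ys, y ∈ a)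
    (h : a ≤ (Ideal.ofList ys).radical) : cohDim a R ≤ ys.length := by
  apply sSup_le
  rintro _ ⟨i, hi, rfl⟩
  rw [Set.mem_ofPred_eq, nontrivial_lc] at hi
  by_contra hlt
  exact hi (LCV_big a ys hys R (PP_ring a ys h) i (by simpa using hlt))

theorem cd_attained (a : Ideal R) (c : ℕ) (hc : 0 < c) (h : (c : ℕ∞) = cohDim a R) :
    ¬ LCV a (ModuleCat.of R R) c := by
  intro hL
  have : cohDim a R ≤ ((c - 1 : ℕ) : ℕ∞) := by
    apply sSup_le
    rintro _ ⟨i, hi, rfl⟩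
    have h1 : (i : ℕ∞) ≤ cohDim a R := le_sSup ⟨i, hi, rfl⟩
    rw [Set.mem_ofPred_eq, nontrivial_lc] at hi
    have h2 : i ≠ c := by rintro rfl; exact hi hL
    rw [← h] at h1
    have h3 : i ≤ c := by exact_mod_cast h1
    have h4 : i ≤ c - 1 := by omega
    exact Nat.cast_le.2 h4
  rw [← h] at this
  have h4 : c ≤ c - 1 := by exact_mod_cast this
  omega

theorem IL_append (xs ys : List R) (k : ℕ) : IL (xs ++ ys) k = IL xs k ⊔ IL ys k := by
  rw [IL, List.map_append, Ideal.ofList_append]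

theorem EE_lift [IsNoetherianRing R] (xs ys : List R)
    (h : ∀ k, ∃ l, ys.prod ^ l ∈ IL ys (k + l) ⊔ Ideal.ofList xs) : EE (xs ++ ys) R := by
  have G : ∀ t k, ∃ l, ys.prod ^ l ∈ IL ys (k + l) ⊔ Ideal.ofList xs ^ t := by
    intro t
    induction t with
    | zero => intro k; exact ⟨0, by simp⟩
    | succ t ih =>
      intro k
      obtain ⟨l, hl⟩ := h k
      obtain ⟨l', hl'⟩ := ih (k + l)
      obtain ⟨u, hu, i, hi, he⟩ := Submodule.mem_sup.1 hl
      obtain ⟨u', hu', i', hi', he'⟩ := Submodule.mem_sup.1 hl'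
      refine ⟨l + l', ?_⟩
      have : ys.prod ^ (l + l') = (ys.prod ^ l' * u + i * u') + i' * i := by
        rw [pow_add, ← he, add_mul, ← he']; ring
      rw [this]
      refine add_mem (Ideal.mem_sup_left (add_mem ?_ ?_)) (Ideal.mem_sup_right ?_)
      · rw [← add_assoc]; exact prod_IL ys _ _ _ hu
      · rw [← add_assoc]; exact Ideal.mul_mem_left _ _ hu'
      · rw [pow_succ]; exact Ideal.mul_mem_mul hi' hi
  intro m k
  have hrad : Ideal.ofList xs ≤ (IL xs k).radical := by
    rw [Ideal.ofList, Ideal.span_le]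
    intro x hx
    exact ⟨k, Ideal.subset_span (List.mem_map.2 ⟨x, hx, rfl⟩)⟩
  obtain ⟨t, ht⟩ := Ideal.exists_pow_le_of_le_radical_of_fg hrad (IsNoetherian.noetherian _)
  obtain ⟨l, hl⟩ := G t k
  obtain ⟨u, hu, i, hi, he⟩ := Submodule.mem_sup.1 hl
  refine ⟨l, ?_⟩
  rw [smul_eq_mul, smul_eq_mul, Ideal.mul_top, List.prod_append, mul_pow, ← he, IL_append]
  apply Ideal.mul_mem_right
  rw [mul_add]
  exact add_mem (Ideal.mem_sup_right (Ideal.mul_mem_left _ _ hu))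
    (Ideal.mem_sup_left (prod_IL xs _ _ _ (ht hi)))

theorem cd_quot [IsNoetherianRing R] (a : Ideal R) (xs ys : List R) (hxy : ∀ z ∈ xs ++ ys, z ∈ a)
    (hrad : a ≤ (Ideal.ofList (xs ++ ys)).radical) (hc : ((xs ++ ys).length : ℕ∞) = cohDim a R) :
    cohDim (a.map (Ideal.Quotient.mk (Ideal.ofList xs))) (R ⧸ Ideal.ofList xs) = ys.length := by
  set π := Ideal.Quotient.mk (Ideal.ofList xs) with hπ
  have hys : ∀ z ∈ ys.map π, z ∈ a.map π := by
    intro z hz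
    obtain ⟨y, hy, rfl⟩ := List.mem_map.1 hz
    exact Ideal.mem_map_of_mem _ (hxy y (by simp [hy]))
  have hr : a.map π ≤ (Ideal.ofList (ys.map π)).radical := by
    rw [Ideal.map_le_iff_le_comap]
    intro r hr
    obtain ⟨m, hm⟩ := hrad hr
    refine ⟨m, ?_⟩
    have := Ideal.mem_map_of_mem π hm
    rw [Ideal.ofList_append, Ideal.map_sup, Ideal.map_quotient_self, bot_sup_eq, Ideal.map_ofList, map_pow] at this
    exact this
  have hle : cohDim (a.map π) (R ⧸ Ideal.ofList xs) ≤ ys.length := by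
    simpa using cd_le _ _ hys hr
  refine le_antisymm hle ?_
  rcases Nat.eq_zero_or_pos ys.length with h0 | hpos
  · rw [h0]; simp
  apply le_sSup
  refine ⟨ys.length, ?_, rfl⟩
  rw [Set.mem_ofPred_eq, nontrivial_lc]
  intro hL
  have hL' : LCV (a.map π) (ModuleCat.of (R ⧸ Ideal.ofList xs) (R ⧸ Ideal.ofList xs)) (ys.map π).length := by
    rwa [List.length_map]
  rw [LCV_iff_EE _ _ hys _ (PP_ring _ _ hr)] at hL'
  refine cd_attained a _ (by simp; omega) hc ((LCV_iff_EE a _ hxy R (PP_ring _ _ hrad)).2 (EE_lift xs ys ?_))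
  intro k
  obtain ⟨l, hl⟩ := hL' 1 k
  refine ⟨l, ?_⟩
  have h1 : IL (ys.map π) (k + l) = (IL ys (k + l)).map π := by
    rw [IL, IL, Ideal.map_ofList, List.map_map, List.map_map]
    congr 2
  rw [h1, smul_eq_mul, smul_eq_mul, Ideal.mul_top, mul_one, ← map_list_prod, ← map_pow] at hl
  exact Ideal.mem_quotient_iff_mem_sup.1 hl

end CD


section Rees

open Abelian RingTheory.Sequence
open scoped Pointwise

theorem sesx {M : Type u} [AddCommGroup M] [Module R M] (x : R) (hx : IsSMulRegular M x) :
    ∃ h, (mkS (x • LinearMap.id : M →ₗ[R] M) (x • (⊤ : Submodule R M)).mkQ h).ShortExact := by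
  have h : Function.Exact (x • LinearMap.id : M →ₗ[R] M) (x • (⊤ : Submodule R M)).mkQ := by
    intro m
    rw [Submodule.mkQ_apply, Submodule.Quotient.mk_eq_zero, Submodule.mem_smul_pointwise_iff_exists]
    constructor
    · rintro ⟨m', -, rfl⟩
      exact ⟨m', rfl⟩
    · rintro ⟨m', rfl⟩
      exact ⟨m', trivial, rfl⟩
  exact ⟨h, mkS_exact _ _ h hx (Submodule.mkQ_surjective _)⟩

theorem comp_smul_zero {Y : ModuleCat.{u} R} (x : R) (hY : ∀ y : Y, x • y = 0) {M : Type u} [AddCommGroup M]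
    [Module R M] {i : ℕ} (ξ : Abelian.Ext.{u} Y (ModuleCat.of R M) i) :
    ξ.comp (Ext.mk₀ (ModuleCat.ofHom (x • LinearMap.id : M →ₗ[R] M))) (add_zero i) = 0 := by
  have : ModuleCat.ofHom (x • LinearMap.id : M →ₗ[R] M) = x • 𝟙 (ModuleCat.of R M) := rfl
  rw [this, Ext.mk₀_smul, Ext.comp_smul]
  exact smul_ext_eq_zero x hY _

theorem rees_zero (rs : List R) : ∀ (M : Type u) [AddCommGroup M] [Module R M], IsWeaklyRegular M rs →
    ∀ (Y : ModuleCat.{u} R) (_ : ∀ x ∈ rs, ∀ y : Y, x • y = 0) (i : ℕ), i < rs.length →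
      ∀ ξ : Abelian.Ext.{u} Y (ModuleCat.of R M) i, ξ = 0 := by
  induction rs with
  | nil => intro M _ _ _ Y _ i hi; simp at hi
  | cons x rs ih =>
    intro M _ _ hreg Y hY i hi ξ
    rw [isWeaklyRegular_cons_iff] at hreg
    cases i with
    | zero =>
      obtain ⟨f, rfl⟩ := (Ext.mk₀_bijective _ _).2 ξ
      have hf : f = 0 := by
        apply ModuleCat.hom_ext
        ext y
        apply hreg.1
        change x • f.hom y = x • (0 : M)
        rw [← map_smul, hY x (by simp), map_zero, smul_zero]
      rw [hf, Ext.mk₀_zero]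
    | succ i =>
      obtain ⟨h, hS⟩ := sesx (M := M) x hreg.1
      have h0 : ξ.comp (Ext.mk₀ (mkS _ _ h).f) (add_zero (i + 1)) = 0 :=
        comp_smul_zero x (hY x (by simp)) ξ
      obtain ⟨η, hη⟩ := Ext.covariant_sequence_exact₁ _ hS (n₀ := i) ξ h0 rfl
      have hη0 : η = 0 := ih (QuotSMulTop x M) hreg.2 Y (fun z hz => hY z (by simp [hz])) i (by simpa using hi) η
      rw [hη0] at hη
      rw [← hη]
      exact Ext.zero_comp ..

theorem comp_iso_bij {Y A B : ModuleCat.{u} R} (e : A ≅ B) : Function.Bijective (fun f : Y ⟶ A => f ≫ e.hom) := by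
  constructor
  · intro f g h
    exact (cancel_mono e.hom).1 h
  · intro g
    exact ⟨g ≫ e.inv, by simp⟩

theorem rees_top (rs : List R) : ∀ (M : Type u) [AddCommGroup M] [Module R M], IsWeaklyRegular M rs →
    ∃ θ : Abelian.Ext.{u} (ModuleCat.of R (M ⧸ Ideal.ofList rs • (⊤ : Submodule R M))) (ModuleCat.of R M) rs.length,
    ∀ (Y : ModuleCat.{u} R) (_ : ∀ x ∈ rs, ∀ y : Y, x • y = 0),
      Function.Bijective (fun f : Y ⟶ (ModuleCat.of R (M ⧸ Ideal.ofList rs • (⊤ : Submodule R M))) =>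
        (Ext.mk₀ f).comp θ (zero_add _)) := by
  induction rs with
  | nil =>
    intro M _ _ _
    let e : ModuleCat.of R (M ⧸ Ideal.ofList ([] : List R) • (⊤ : Submodule R M)) ≅ ModuleCat.of R M :=
      (Submodule.quotEquivOfEqBot _ (by simp)).toModuleIso
    refine ⟨Ext.mk₀ e.hom, fun Y _ => ?_⟩
    have : (fun f : Y ⟶ (ModuleCat.of R (M ⧸ Ideal.ofList ([] : List R) • (⊤ : Submodule R M))) =>
        (Ext.mk₀ f).comp (Ext.mk₀ e.hom) (zero_add _)) = Ext.mk₀ ∘ (fun f => f ≫ e.hom) := by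
      funext f
      simp
    exact this ▸ (Ext.mk₀_bijective _ _).comp (comp_iso_bij e)
  | cons x rs ih =>
    intro M _ _ hreg
    have hreg0 := hreg
    rw [isWeaklyRegular_cons_iff] at hreg
    obtain ⟨θ', hθ'⟩ := ih (QuotSMulTop x M) hreg.2
    obtain ⟨h, hS⟩ := sesx (M := M) x hreg.1
    let e := (Submodule.quotOfListConsSMulTopEquivQuotSMulTopInner M x rs).toModuleIso
    let δ : Abelian.Ext.{u} (ModuleCat.of R (QuotSMulTop x M)) (ModuleCat.of R M) 1 := hS.extClass
    refine ⟨(Ext.mk₀ e.hom).comp (θ'.comp δ rfl) (zero_add _), fun Y hY => ?_⟩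
    have hδ : Function.Bijective (fun η : Abelian.Ext.{u} Y (ModuleCat.of R (QuotSMulTop x M)) rs.length =>
        η.comp δ (rfl : rs.length + 1 = (x :: rs).length)) := by
      constructor
      · have : Function.Injective (AddMonoidHom.mk' (fun η : Abelian.Ext.{u} Y (ModuleCat.of R (QuotSMulTop x M)) rs.length =>
          η.comp δ (rfl : rs.length + 1 = (x :: rs).length)) (by intro a b; exact Ext.add_comp _ _ _ _)) := by
          rw [injective_iff_map_eq_zero]
          intro η hη
          obtain ⟨ζ, hζ⟩ := Ext.covariant_sequence_exact₃ Y hS η rfl hη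
          have hζ0 : ζ = 0 := rees_zero (x :: rs) M hreg0 Y hY _ (by simp) ζ
          rw [hζ0] at hζ
          rw [← hζ]
          exact Ext.zero_comp ..
        exact this
      · intro ξ
        have h0 : ξ.comp (Ext.mk₀ (mkS _ _ h).f) (add_zero _) = 0 :=
          comp_smul_zero x (hY x (by simp)) ξ
        exact Ext.covariant_sequence_exact₁ _ hS (n₀ := rs.length) ξ h0 rfl
    have : (fun f : Y ⟶ (ModuleCat.of R (M ⧸ Ideal.ofList (x :: rs) • (⊤ : Submodule R M))) =>
        (Ext.mk₀ f).comp ((Ext.mk₀ e.hom).comp (θ'.comp δ rfl) (zero_add _)) (zero_add _)) =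
        (fun η : Abelian.Ext.{u} Y (ModuleCat.of R (QuotSMulTop x M)) rs.length =>
        η.comp δ (rfl : rs.length + 1 = (x :: rs).length)) ∘ 
        ((fun f => (Ext.mk₀ f).comp θ' (zero_add _)) ∘ (fun f => f ≫ e.hom)) := by
      funext f
      simp only [Function.comp_apply]
      rw [Ext.mk₀_comp_mk₀_assoc, Ext.comp_assoc]
      simp
    exact this ▸ hδ.comp ((hθ' Y (fun z hz => hY z (by simp [hz]))).comp (comp_iso_bij e))

theorem pd_quot (rs : List R) : ∀ (M : Type u) [AddCommGroup M] [Module R M], IsWeaklyRegular M rs →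
    ∀ d, HasProjectiveDimensionLT (ModuleCat.of R M) d →
     HasProjectiveDimensionLT (ModuleCat.of R (M ⧸ Ideal.ofList rs • (⊤ : Submodule R M))) (d + rs.length) := by
  induction rs with
  | nil =>
    intro M _ _ _ d hd
    let e : ModuleCat.of R (M ⧸ Ideal.ofList ([] : List R) • (⊤ : Submodule R M)) ≅ ModuleCat.of R M :=
      (Submodule.quotEquivOfEqBot _ (by simp)).toModuleIso
    exact hasProjectiveDimensionLT_of_iso e.symm d
  | cons x rs ih =>
    intro M _ _ hreg d hd
    rw [isWeaklyRegular_cons_iff] at hreg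
    obtain ⟨h, hS⟩ := sesx (M := M) x hreg.1
    have hd1 : HasProjectiveDimensionLT (ModuleCat.of R M) (d + 1) :=
      hasProjectiveDimensionLT_of_ge _ d _ (by omega)
    have h3 : HasProjectiveDimensionLT (ModuleCat.of R (QuotSMulTop x M)) (d + 1) :=
      hS.hasProjectiveDimensionLT_X₃ d hd hd1
    have := ih _ hreg.2 _ h3
    let e := (Submodule.quotOfListConsSMulTopEquivQuotSMulTopInner M x rs).toModuleIso
    rw [show d + (x :: rs).length = d + 1 + rs.length by simp; omega]
    exact hasProjectiveDimensionLT_of_iso e.symm _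

theorem pd_pi (T : Type u) [AddCommGroup T] [Module R T] (d : ℕ)
    (hT : HasProjectiveDimensionLT (ModuleCat.of R T) d) (m : ℕ) :
    HasProjectiveDimensionLT (ModuleCat.of R (Fin m → T)) d := by
  induction m with
  | zero =>
    have : IsZero (ModuleCat.of R (Fin 0 → T)) := ModuleCat.isZero_of_subsingleton _
    have := this.hasProjectiveDimensionLT_zero
    exact hasProjectiveDimensionLT_of_ge _ 0 _ (by omega)
  | succ m ih =>
    let f : T →ₗ[R] (Fin (m + 1) → T) := LinearMap.single R (fun _ => T) 0
    let g : (Fin (m + 1) → T) →ₗ[R] (Fin m → T) := LinearMap.funLeft R T Fin.succ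
    have h : Function.Exact f g := by
      intro v
      constructor
      · intro hv
        refine ⟨v 0, ?_⟩
        funext i
        refine Fin.cases ?_ (fun j => ?_) i
        · simp [f]
        · have := congrFun hv j
          simp only [g, LinearMap.funLeft_apply, Pi.zero_apply] at this
          simp [f, this]
      · rintro ⟨t, rfl⟩
        funext j
        simp [f, g, LinearMap.funLeft_apply]
    have hS := mkS_exact f g h (fun s t hst => Pi.single_injective (M := fun _ : Fin (m + 1) => T) 0 hst) (by
      intro w
      exact ⟨Fin.cons 0 w, by funext j; simp [g, LinearMap.funLeft_apply]⟩)
    exact hS.hasProjectiveDimensionLT_X₂ d hT ih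

theorem ext_sub_surj {S : ShortComplex (ModuleCat.{u} R)} (hS : S.ShortExact) (N : ModuleCat.{u} R) (j : ℕ)
    (h2 : Subsingleton (Abelian.Ext.{u} S.X₂ N (j + 1))) :
    Subsingleton (Abelian.Ext.{u} S.X₃ N (j + 1)) ↔
      ∀ ξ : Abelian.Ext.{u} S.X₁ N j, ∃ η : Abelian.Ext.{u} S.X₂ N j, (Ext.mk₀ S.f).comp η (zero_add j) = ξ := by
  constructor
  · intro h ξ
    exact Ext.contravariant_sequence_exact₁ hS N ξ (add_comm 1 j) (Subsingleton.elim _ _)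
  · intro h
    refine subsingleton_of_forall_eq 0 fun ξ => ?_
    obtain ⟨ζ, hζ⟩ := Ext.contravariant_sequence_exact₃ hS N ξ (Subsingleton.elim _ _) (add_comm 1 j)
    obtain ⟨η, rfl⟩ := h ζ
    rw [← hζ, ← Ext.comp_assoc _ _ _ (add_zero 1) (zero_add j) (by omega), hS.extClass_comp, Ext.zero_comp]

theorem ext_sub_shift {S : ShortComplex (ModuleCat.{u} R)} (hS : S.ShortExact) (N : ModuleCat.{u} R) (j : ℕ)
    (h2 : Subsingleton (Abelian.Ext.{u} S.X₂ N (j + 1))) (h1 : Subsingleton (Abelian.Ext.{u} S.X₂ N j)) :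
    Subsingleton (Abelian.Ext.{u} S.X₃ N (j + 1)) ↔ Subsingleton (Abelian.Ext.{u} S.X₁ N j) := by
  rw [ext_sub_surj hS N j h2]
  constructor
  · intro h
    refine subsingleton_of_forall_eq 0 fun ξ => ?_
    obtain ⟨η, rfl⟩ := h ξ
    rw [Subsingleton.elim η 0, Ext.comp_zero]
  · intro h ξ
    exact ⟨0, Subsingleton.elim _ _⟩

end Rees


section Rees2

open Abelian RingTheory.Sequence

theorem ext_zero_sub_iff {A : Type u} [CommRing A] (Y Z : ModuleCat.{u} A) :
    Subsingleton (Abelian.Ext.{u} Y Z 0) ↔ ∀ f : Y ⟶ Z, f = 0 := by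
  constructor
  · intro h f
    exact (Ext.mk₀_bijective Y Z).1 (Subsingleton.elim _ _)
  · intro h
    refine subsingleton_of_forall_eq 0 fun ξ => ?_
    obtain ⟨f, rfl⟩ := (Ext.mk₀_bijective _ _).2 ξ
    rw [h f, Ext.mk₀_zero]

theorem rees_C [IsNoetherianRing R] (rs : List R) (M : Type u) [AddCommGroup M] [Module R M]
    (Mb : Type u) [AddCommGroup Mb] [Module R Mb] [Module (R ⧸ Ideal.ofList rs) Mb]
    [IsScalarTower R (R ⧸ Ideal.ofList rs) Mb]
    (θ : Abelian.Ext.{u} (ModuleCat.of R Mb) (ModuleCat.of R M) rs.length)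
    (hθ : ∀ (Y : ModuleCat.{u} R) (_ : ∀ x ∈ rs, ∀ y : Y, x • y = 0),
      Function.Bijective (fun f : Y ⟶ ModuleCat.of R Mb => (Ext.mk₀ f).comp θ (zero_add _)))
    (hpd : HasProjectiveDimensionLT (ModuleCat.of R (R ⧸ Ideal.ofList rs)) (rs.length + 1)) (i : ℕ) :
    ∀ (Y : Type u) [AddCommGroup Y] [Module R Y] [Module (R ⧸ Ideal.ofList rs) Y]
      [IsScalarTower R (R ⧸ Ideal.ofList rs) Y] [Module.Finite (R ⧸ Ideal.ofList rs) Y],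
      Subsingleton (Abelian.Ext.{u} (ModuleCat.of R Y) (ModuleCat.of R M) (rs.length + i)) ↔
      Subsingleton (Abelian.Ext.{u} (ModuleCat.of (R ⧸ Ideal.ofList rs) Y)
        (ModuleCat.of (R ⧸ Ideal.ofList rs) Mb) i) := by
  have hsurj : Function.Surjective (algebraMap R (R ⧸ Ideal.ofList rs)) := Ideal.Quotient.mk_surjective
  have hkill : ∀ (Y : Type u) [AddCommGroup Y] [Module R Y] [Module (R ⧸ Ideal.ofList rs) Y]
      [IsScalarTower R (R ⧸ Ideal.ofList rs) Y], ∀ x ∈ rs, ∀ y : Y, x • y = 0 := by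
    intro Y _ _ _ _ x hx y
    rw [← algebraMap_smul (R ⧸ Ideal.ofList rs) x y]
    have : algebraMap R (R ⧸ Ideal.ofList rs) x = 0 :=
      Ideal.Quotient.eq_zero_iff_mem.2 (Ideal.subset_span hx)
    rw [this, zero_smul]
  induction i with
  | zero =>
    intro Y _ _ _ _ _
    rw [ext_zero_sub_iff]
    have hb := hθ (ModuleCat.of R Y) (hkill Y)
    constructor
    · intro h f
      have h1 : ModuleCat.ofHom (f.hom.restrictScalars R) = (0 : ModuleCat.of R Y ⟶ ModuleCat.of R Mb) :=
        hb.1 (@Subsingleton.elim _ h _ _)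
      ext y
      exact congrArg (fun g => g.hom y) h1
    · intro h
      refine subsingleton_of_forall_eq 0 fun ξ => ?_
      obtain ⟨f, rfl⟩ := hb.2 ξ
      have h1 := h (ModuleCat.ofHom (f.hom.extendScalarsOfSurjective hsurj))
      have h2 : f = 0 := by
        ext y
        exact congrArg (fun g => g.hom y) h1
      rw [h2]
      simp only [Ext.mk₀_zero, Ext.zero_comp]
  | succ i ih =>
    intro Y _ _ _ _ _
    obtain ⟨m, g, hg⟩ := Module.Finite.exists_fin' (R ⧸ Ideal.ofList rs) Y
    have hpF := pd_pi (R := R) (R ⧸ Ideal.ofList rs) _ hpd m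
    have hF : ∀ j, Subsingleton (Abelian.Ext.{u} (ModuleCat.of R (Fin m → R ⧸ Ideal.ofList rs))
        (ModuleCat.of R M) (rs.length + j + 1)) := fun j =>
      HasProjectiveDimensionLT.subsingleton _ (rs.length + 1) _ (by omega) _
    have hFS : ∀ j, Subsingleton (Abelian.Ext.{u} (ModuleCat.of (R ⧸ Ideal.ofList rs) (Fin m → R ⧸ Ideal.ofList rs))
        (ModuleCat.of (R ⧸ Ideal.ofList rs) Mb) (j + 1)) := fun j => Ext.subsingleton_of_projective _ _ _
    have hex : Function.Exact (LinearMap.ker g).subtype g := LinearMap.exact_subtype_ker_map g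
    have hS := mkS_exact _ _ hex (Submodule.subtype_injective _) hg
    have hexR : Function.Exact ((LinearMap.ker g).subtype.restrictScalars R) (g.restrictScalars R) := hex
    have hSR := mkS_exact _ _ hexR (Submodule.subtype_injective _) hg
    cases i with
    | zero =>
      have e1 := ext_sub_surj hS (ModuleCat.of _ Mb) 0 (hFS 0)
      have e2 := ext_sub_surj hSR (ModuleCat.of R M) (rs.length + 0) (hF 0)
      refine e2.trans (Iff.trans ?_ e1.symm)
      have hbF := hθ (ModuleCat.of R (Fin m → R ⧸ Ideal.ofList rs)) (hkill _)
      have hbK := hθ (ModuleCat.of R (LinearMap.ker g)) (hkill _)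
      constructor
      · intro h ξ
        obtain ⟨f, rfl⟩ := (Ext.mk₀_bijective _ _).2 ξ
        let f' : LinearMap.ker g →ₗ[R ⧸ Ideal.ofList rs] Mb := f.hom
        obtain ⟨η, hη⟩ := h ((Ext.mk₀ (ModuleCat.ofHom (f'.restrictScalars R) :
          ModuleCat.of R (LinearMap.ker g) ⟶ ModuleCat.of R Mb)).comp θ (zero_add _))
        obtain ⟨k, rfl⟩ := hbF.2 η
        have h1 : (mkS _ _ hexR).f ≫ k = ModuleCat.ofHom (f'.restrictScalars R) := by
          apply hbK.1
          refine Eq.trans ?_ hη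
          exact (Ext.mk₀_comp_mk₀_assoc (mkS _ _ hexR).f k θ).symm
        refine ⟨Ext.mk₀ (ModuleCat.ofHom (k.hom.extendScalarsOfSurjective hsurj)), ?_⟩
        refine (Ext.mk₀_comp_mk₀ _ _).trans ?_
        congr 1
        ext y
        exact congrArg (fun g => g.hom y) h1
      · intro h ξ
        obtain ⟨f, rfl⟩ := hbK.2 ξ
        obtain ⟨η, hη⟩ := h (Ext.mk₀ (ModuleCat.ofHom (f.hom.extendScalarsOfSurjective hsurj)))
        obtain ⟨k, rfl⟩ := (Ext.mk₀_bijective _ _).2 η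
        let k' : (Fin m → R ⧸ Ideal.ofList rs) →ₗ[R ⧸ Ideal.ofList rs] Mb := k.hom
        have h1 := (Ext.mk₀_bijective _ _).1 ((Ext.mk₀_comp_mk₀ _ _).symm.trans hη)
        refine ⟨(Ext.mk₀ (ModuleCat.ofHom (k'.restrictScalars R) :
          ModuleCat.of R (Fin m → R ⧸ Ideal.ofList rs) ⟶ ModuleCat.of R Mb)).comp θ (zero_add _), ?_⟩
        refine (Ext.mk₀_comp_mk₀_assoc (mkS _ _ hexR).f _ θ).trans ?_
        have h2 : (mkS _ _ hexR).f ≫ (ModuleCat.ofHom (k'.restrictScalars R) :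
          ModuleCat.of R (Fin m → R ⧸ Ideal.ofList rs) ⟶ ModuleCat.of R Mb) = f := by
          ext y
          exact congrArg (fun g => g.hom y) h1
        exact congrArg (fun f => (Ext.mk₀ f).comp θ (zero_add _)) h2
    | succ i =>
      have e1 := ext_sub_shift hS (ModuleCat.of _ Mb) (i + 1) (hFS _) (hFS _)
      have e2 := ext_sub_shift hSR (ModuleCat.of R M) (rs.length + (i + 1)) (hF _) (hF _)
      exact e2.trans ((ih (LinearMap.ker g)).trans e1.symm)

theorem ext_sub_iso {A : Type u} [CommRing A] {X Y : ModuleCat.{u} A} (e : X ≅ Y) (Z : ModuleCat.{u} A) (i : ℕ)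
    (h : Subsingleton (Abelian.Ext.{u} X Z i)) : Subsingleton (Abelian.Ext.{u} Y Z i) := by
  refine subsingleton_of_forall_eq 0 fun ξ => ?_
  have : ξ = (Ext.mk₀ e.inv).comp ((Ext.mk₀ e.hom).comp ξ (zero_add i)) (zero_add i) := by
    rw [Ext.mk₀_comp_mk₀_assoc, e.inv_hom_id, Ext.mk₀_id_comp]
  rw [this, Subsingleton.elim ((Ext.mk₀ e.hom).comp ξ (zero_add i)) 0, Ext.comp_zero]

theorem main18 [IsNoetherianRing R] (a : Ideal R)
    (M : Type u) [AddCommGroup M] [Module R M] (rs : List R)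
    (hsop : ∃ rs' : List R, rs <+: rs' ∧ IsRelSOP a R rs')
    (hregM : IsWeaklyRegular M rs) (hregR : IsWeaklyRegular R rs) :
    IsRelGorenstein a M ↔
      IsRelGorenstein (a.map (Ideal.Quotient.mk (Ideal.ofList rs)))
        (M ⧸ ((Ideal.ofList rs) • (⊤ : Submodule R M))) := by
  obtain ⟨_, ⟨ys, rfl⟩, hlen, hmem, hrad⟩ := hsop
  have hann : Module.annihilator R R = ⊥ := by
    rw [eq_bot_iff]
    intro r hr
    simpa using Module.mem_annihilator.1 hr 1
  have hrad' : a ≤ (Ideal.ofList (rs ++ ys)).radical := by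
    rw [hann] at hrad
    simp only [Submodule.add_eq_sup, sup_bot_eq] at hrad
    rw [Ideal.ofList, hrad]
    exact Ideal.le_radical
  have hcd := cd_quot a rs ys hmem hrad' hlen
  have hIa : Ideal.ofList rs ≤ a := by
    rw [Ideal.ofList, Ideal.span_le]
    intro x hx
    exact hmem x (List.mem_append_left _ hx)
  obtain ⟨θ, hθ⟩ := rees_top rs M hregM
  have hpd : HasProjectiveDimensionLT (ModuleCat.of R (R ⧸ Ideal.ofList rs)) (rs.length + 1) := by
    have h1 := pd_quot rs R hregR 1 inferInstance
    rw [add_comm]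
    have he : Ideal.ofList rs • (⊤ : Submodule R R) = Ideal.ofList rs := by simp
    exact hasProjectiveDimensionLT_of_iso (Submodule.quotEquivOfEq _ _ he).toModuleIso _
  have hC := fun i => rees_C rs M (M ⧸ ((Ideal.ofList rs) • (⊤ : Submodule R M))) θ hθ hpd i
    ((R ⧸ Ideal.ofList rs) ⧸ (a.map (Ideal.Quotient.mk (Ideal.ofList rs))))
  let e : ((R ⧸ Ideal.ofList rs) ⧸ (a.map (Ideal.Quotient.mk (Ideal.ofList rs)))) ≃ₗ[R] (R ⧸ a) :=
    (DoubleQuot.quotQuotEquivQuotOfLEₐ R hIa).toLinearEquiv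
  have hkill : ∀ x ∈ rs, ∀ y : R ⧸ a, x • y = 0 := by
    intro x hx y
    obtain ⟨y, rfl⟩ := Submodule.Quotient.mk_surjective _ y
    rw [← Submodule.Quotient.mk_smul, Submodule.Quotient.mk_eq_zero]
    exact Ideal.mul_mem_right _ _ (hIa (Ideal.subset_span hx))
  have hC' : ∀ i, Subsingleton (Abelian.Ext.{u} (ModuleCat.of R (R ⧸ a)) (ModuleCat.of R M) (rs.length + i)) ↔
      Subsingleton (Abelian.Ext.{u} (ModuleCat.of (R ⧸ Ideal.ofList rs)
        ((R ⧸ Ideal.ofList rs) ⧸ (a.map (Ideal.Quotient.mk (Ideal.ofList rs)))))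
        (ModuleCat.of (R ⧸ Ideal.ofList rs) (M ⧸ ((Ideal.ofList rs) • (⊤ : Submodule R M)))) i) := by
    intro i
    rw [← hC i]
    exact ⟨ext_sub_iso e.toModuleIso.symm _ _, ext_sub_iso e.toModuleIso _ _⟩
  unfold IsRelGorenstein
  rw [hcd, ← hlen]
  simp only [ext_subsingleton_iff]
  constructor
  · intro h i hi
    rw [← hC']
    apply h
    intro h'
    apply hi
    rw [List.length_append] at h'
    have : rs.length + i = rs.length + ys.length := by exact_mod_cast h'
    have : i = ys.length := by omega
    rw [this]
  · intro h i hi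
    by_cases hin : i < rs.length
    · exact subsingleton_of_forall_eq 0 (rees_zero rs M hregM _ hkill i hin)
    · obtain ⟨j, rfl⟩ := Nat.exists_eq_add_of_le (not_lt.1 hin)
      rw [hC']
      apply h
      intro h'
      apply hi
      have : j = ys.length := by exact_mod_cast h'
      rw [this, List.length_append]

end Rees2

end Aux18

theorem stmt18 {R : Type u} [CommRing R] [IsNoetherianRing R]
    (a : Ideal R) (ha : a ≠ ⊤)
    (M : Type u) [AddCommGroup M] [Module R M] [Module.Finite R M] (rs : List R)
    (hsop : ∃ rs' : List R, rs <+: rs' ∧ IsRelSOP a R rs')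
    (hregM : RingTheory.Sequence.IsRegular M rs)
    (hregR : RingTheory.Sequence.IsRegular R rs) :
    IsRelGorenstein a M ↔
      IsRelGorenstein (a.map (Ideal.Quotient.mk (Ideal.span {x | x ∈ rs})))
        (M ⧸ ((Ideal.span {x | x ∈ rs}) • (⊤ : Submodule R M))) := by
  exact main18 a M rs hsop hregM.toIsWeaklyRegular hregR.toIsWeaklyRegular

end
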